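/- arXiv:2310.09707 — 2 statements merged into one kernel-verified Lean document; each statement's English description precedes it below -/
import Mathlib

section
/- Let N > r > 0, let X₁ ∈ ℝ^{(N−r)×(N−r)} and X₂ ∈ ℝ^{r×r} be symmetric positive definite, set A₀ = diag(X₁, X₂), and let A₁, A₂ ∈ ℝ^{N×N} be matrices such that A₀A₁ and A₀A₂ are symmetric (assumption (i)). Let e ∈ ℝ^{r×r} be such that X₂e + eᵀX₂ is positive definite (assumption (ii)). Suppose there exist real numbers α, β such that X₁(αa₁ + βa₂) is negative definite, where a₁, a₂ are the top-left (N−r)×(N−r) blocks of A₁, A₂ (assumption (iii)). Let Ω ⊆ ℝ² be a bounded set. Then there exist constants K and ν > 0 such that λ(x, y) := K + αx + βy > 0 for all (x, y) in the closure of Ω, and for every continuously differentiable U : ℝ × ℝ × ℝ → ℝ^N satisfying Uₜ + A₁Uₓ + A₂U_y = QU (with Q the block matrix [[0,0],[0,−e]]) one has, at every point (t, x, y) with (x, y) in the closure of Ω: ∂ₜ(λUᵀA₀U) + ∂ₓ(λUᵀA₀A₁U) + ∂_y(λUᵀA₀A₂U) ≤ −ν λ UᵀA₀U. -/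
open Matrix

section QuadraticBounds

variable {m n : Type*} [Fintype m] [Fintype n]

lemma Matrix.dotProduct_self_nonneg_real (x : n → ℝ) : 0 ≤ x ⬝ᵥ x :=
  Finset.sum_nonneg fun i _ => mul_self_nonneg (x i)

lemma Matrix.two_mul_dotProduct_le (x y : n → ℝ) {c : ℝ} (hc : 0 < c) :
    2 * (x ⬝ᵥ y) ≤ c * (x ⬝ᵥ x) + c⁻¹ * (y ⬝ᵥ y) := by
  simp only [dotProduct, Finset.mul_sum, ← Finset.sum_add_distrib]
  refine Finset.sum_le_sum fun i _ => ?_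
  have h : c * (x i * x i) + c⁻¹ * (y i * y i) - 2 * (x i * y i) = c⁻¹ * (c * x i - y i) ^ 2 := by
    field_simp
    ring
  have : 0 ≤ c⁻¹ * (c * x i - y i) ^ 2 := by positivity
  linarith

lemma Matrix.exists_mulVec_dotProduct_self_le (M : Matrix m n ℝ) :
    ∃ C > 0, ∀ x : n → ℝ, (M *ᵥ x) ⬝ᵥ (M *ᵥ x) ≤ C * (x ⬝ᵥ x) := by
  refine ⟨∑ i, ∑ j, M i j ^ 2 + 1, by positivity, fun x => ?_⟩
  have h : (M *ᵥ x) ⬝ᵥ (M *ᵥ x) ≤ (∑ i, ∑ j, M i j ^ 2) * (x ⬝ᵥ x) := by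
    rw [Finset.sum_mul]
    refine Finset.sum_le_sum fun i _ => ?_
    have := Finset.sum_mul_sq_le_sq_mul_sq Finset.univ (M i) x
    simpa only [mulVec, dotProduct, sq] using this
  linarith [dotProduct_self_nonneg_real x]

lemma Matrix.exists_dotProduct_mulVec_le (M : Matrix n n ℝ) :
    ∃ C > 0, ∀ x : n → ℝ, x ⬝ᵥ (M *ᵥ x) ≤ C * (x ⬝ᵥ x) := by
  obtain ⟨C, hC, h⟩ := M.exists_mulVec_dotProduct_self_le
  refine ⟨(1 + C) / 2, by positivity, fun x => ?_⟩
  have := two_mul_dotProduct_le x (M *ᵥ x) one_pos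
  linarith [h x]

open scoped MatrixOrder in
lemma Matrix.PosDef.exists_le_dotProduct_mulVec {P : Matrix n n ℝ} (hP : P.PosDef) :
    ∃ c > 0, ∀ x : n → ℝ, c * (x ⬝ᵥ x) ≤ x ⬝ᵥ (P *ᵥ x) := by
  classical
  have hu := hP.isUnit
  obtain ⟨B, rfl⟩ := CStarAlgebra.nonneg_iff_eq_star_mul_self.mp hP.posSemidef.nonneg
  have hB : B⁻¹ * B = 1 := by
    refine nonsing_inv_mul B ?_
    rw [isUnit_iff_isUnit_det, det_mul] at hu
    exact isUnit_of_mul_isUnit_right hu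
  obtain ⟨C, hC, h⟩ := (B⁻¹).exists_mulVec_dotProduct_self_le
  refine ⟨C⁻¹, inv_pos.mpr hC, fun x => ?_⟩
  have hx := h (B *ᵥ x)
  rw [mulVec_mulVec, hB, one_mulVec] at hx
  have hq : x ⬝ᵥ ((star B * B) *ᵥ x) = (B *ᵥ x) ⬝ᵥ (B *ᵥ x) := by
    rw [← mulVec_mulVec, star_eq_conjTranspose, conjTranspose_eq_transpose_of_trivial,
      dotProduct_transpose_mulVec]
  rw [hq, inv_mul_le_iff₀ hC]
  exact hx

/-- A quadratic form that is negative definite on the first block becomes uniformly negative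
definite after a sufficiently large positive definite form on the second block is subtracted. -/
lemma Matrix.exists_uniform_block_decay (M : Matrix (m ⊕ n) (m ⊕ n) ℝ) {P : Matrix n n ℝ}
    (hM : (-M.toBlocks₁₁).PosDef) (hP : P.PosDef) (S : Matrix (m ⊕ n) (m ⊕ n) ℝ) :
    ∃ L₀ > 0, ∀ L₁ > 0, ∃ ν > 0, ∀ l, L₀ ≤ l → l ≤ L₁ → ∀ w : m ⊕ n → ℝ,
      w ⬝ᵥ (M *ᵥ w) - l * (w ∘ Sum.inr ⬝ᵥ (P *ᵥ (w ∘ Sum.inr)))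
        ≤ -ν * (l * (w ⬝ᵥ (S *ᵥ w))) := by
  obtain ⟨c, hc, hMc⟩ := hM.exists_le_dotProduct_mulVec
  obtain ⟨p, hp, hPp⟩ := hP.exists_le_dotProduct_mulVec
  obtain ⟨b, hb, hB⟩ := (M.toBlocks₁₂ + M.toBlocks₂₁ᵀ).exists_mulVec_dotProduct_self_le
  obtain ⟨d, hd, hD⟩ := M.toBlocks₂₂.exists_dotProduct_mulVec_le
  obtain ⟨a, ha, hS⟩ := S.exists_dotProduct_mulVec_le
  refine ⟨2 / p * (c⁻¹ * b + d), by positivity, fun L₁ hL₁ => ?_⟩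
  refine ⟨min (c / (2 * L₁ * a)) (p / (2 * a)), by positivity, fun l hl hl' w => ?_⟩
  set ν := min (c / (2 * L₁ * a)) (p / (2 * a)) with hν
  have hν0 : 0 < ν := by positivity
  have hl0 : 0 < l := lt_of_lt_of_le (by positivity) hl
  have hν₁ : ν * l * a ≤ c / 2 := by
    have h1 : ν * (2 * L₁ * a) ≤ c := (le_div_iff₀ (by positivity)).mp (min_le_left _ _)
    have h2 : ν * a * l ≤ ν * a * L₁ := by gcongr
    linarith
  have hν₂ : ν * l * a ≤ p * l / 2 := by
    have h1 : ν * (2 * a) ≤ p := (le_div_iff₀ (by positivity)).mp (min_le_right _ _)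
    have h2 : ν * (2 * a) * l ≤ p * l := by gcongr
    linarith
  have hl₀ : c⁻¹ * b + d ≤ p * l / 2 := by
    rw [div_mul_eq_mul_div, div_le_iff₀ hp] at hl
    linarith
  set u := w ∘ Sum.inl
  set v := w ∘ Sum.inr
  have hw : w = Sum.elim u v := (Sum.elim_comp_inl_inr w).symm
  have hww : w ⬝ᵥ w = u ⬝ᵥ u + v ⬝ᵥ v := by
    rw [hw, sumElim_dotProduct_sumElim]
  have hMw : w ⬝ᵥ (M *ᵥ w) = u ⬝ᵥ (M.toBlocks₁₁ *ᵥ u)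
      + u ⬝ᵥ ((M.toBlocks₁₂ + M.toBlocks₂₁ᵀ) *ᵥ v) + v ⬝ᵥ (M.toBlocks₂₂ *ᵥ v) := by
    conv_lhs => rw [← fromBlocks_toBlocks M, fromBlocks_mulVec, hw, sumElim_dotProduct_sumElim]
    rw [add_mulVec, dotProduct_add, dotProduct_add, dotProduct_add, dotProduct_transpose_mulVec]
    simp only [Sum.elim_comp_inl, Sum.elim_comp_inr]
    ring
  have h₁ := hMc u
  rw [neg_mulVec, dotProduct_neg] at h₁
  have h₂ := two_mul_dotProduct_le u ((M.toBlocks₁₂ + M.toBlocks₂₁ᵀ) *ᵥ v) hc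
  have h₃ := mul_le_mul_of_nonneg_left (hB v) (inv_pos.mpr hc).le
  have h₄ := hD v
  have h₅ := mul_le_mul_of_nonneg_left (hPp v) hl0.le
  have h₆ := mul_le_mul_of_nonneg_left (hS w) (mul_pos hν0 hl0).le
  have hu := dotProduct_self_nonneg_real u
  have hv := dotProduct_self_nonneg_real v
  have h₇ := mul_le_mul_of_nonneg_right hν₁ hu
  have h₈ := mul_le_mul_of_nonneg_right hν₂ hv
  have h₉ := mul_le_mul_of_nonneg_right hl₀ hv
  have h₁₀ : 0 ≤ c⁻¹ * (b * (v ⬝ᵥ v)) := by positivity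
  rw [hww] at h₆
  rw [hMw]
  linarith

end QuadraticBounds

lemma Matrix.IsSymm.dotProduct_mulVec_comm {n : Type*} [Fintype n] {S : Matrix n n ℝ}
    (hS : S.IsSymm) (x y : n → ℝ) : x ⬝ᵥ (S *ᵥ y) = y ⬝ᵥ (S *ᵥ x) := by
  conv_lhs => rw [← hS.eq, dotProduct_transpose_mulVec]

lemma HasDerivAt.dotProduct_mulVec {m n : Type*} [Fintype m] [Fintype n] {f : ℝ → m → ℝ}
    {g : ℝ → n → ℝ} {f' : m → ℝ} {g' : n → ℝ} {t : ℝ} (hf : HasDerivAt f f' t)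
    (hg : HasDerivAt g g' t) (S : Matrix m n ℝ) :
    HasDerivAt (fun τ => f τ ⬝ᵥ (S *ᵥ g τ)) (f' ⬝ᵥ (S *ᵥ g t) + f t ⬝ᵥ (S *ᵥ g')) t := by
  rw [hasDerivAt_pi] at hf hg
  simp only [mulVec, dotProduct, ← Finset.sum_add_distrib]
  exact HasDerivAt.fun_sum fun i _ =>
    (hf i).mul (HasDerivAt.fun_sum fun j _ => (hg j).const_mul (S i j))

lemma HasDerivAt.mul_quadratic_form {n : Type*} [Fintype n] {S : Matrix n n ℝ} (hS : S.IsSymm)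
    {w : ℝ → n → ℝ} {w' : n → ℝ} {l : ℝ → ℝ} {l' t : ℝ} (hl : HasDerivAt l l' t)
    (hw : HasDerivAt w w' t) :
    HasDerivAt (fun τ => l τ * (w τ ⬝ᵥ (S *ᵥ w τ)))
      (l' * (w t ⬝ᵥ (S *ᵥ w t)) + l t * (2 * (w t ⬝ᵥ (S *ᵥ w')))) t := by
  refine (hl.mul (hw.dotProduct_mulVec hw S)).congr_deriv ?_
  rw [hS.dotProduct_mulVec_comm w' (w t)]
  ring

lemma Bornology.IsBounded.exists_abs_linear_le {Ω : Set (ℝ × ℝ)} (hΩ : Bornology.IsBounded Ω)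
    (α β : ℝ) : ∃ C, ∀ p ∈ closure Ω, |α * p.1 + β * p.2| ≤ C := by
  obtain ⟨C, hC⟩ := hΩ.isCompact_closure.exists_bound_of_continuousOn
    (f := fun p : ℝ × ℝ => α * p.1 + β * p.2) (by fun_prop)
  exact ⟨C, hC⟩

/-- The pointwise differential inequality of Lemma 1 of the paper: under the
structural stability assumptions (i) `A₀ = diag(X₁, X₂)` symmetric positive
definite with `A₀ A₁`, `A₀ A₂` symmetric, (ii) `X₂ e + eᵀ X₂` positive
definite, and (iii) `X₁(α a₁ + β a₂)` negative definite, for every bounded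
`Ω ⊆ ℝ²` there are constants `K` and `ν > 0` with `λ(x,y) = K + αx + βy > 0`
on the closure of `Ω`, such that every `C¹` solution of
`Uₜ + A₁ Uₓ + A₂ U_y = Q U` (with `Q = [[0,0],[0,-e]]`) satisfies
`∂ₜ(λ UᵀA₀U) + ∂ₓ(λ UᵀA₀A₁U) + ∂_y(λ UᵀA₀A₂U) ≤ -ν λ UᵀA₀U`
at every point with `(x, y)` in the closure of `Ω`. -/
theorem stmt_7 {m r : ℕ} (hm : 0 < m) (hr : 0 < r)
    (X₁ : Matrix (Fin m) (Fin m) ℝ) (X₂ : Matrix (Fin r) (Fin r) ℝ)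
    (hX₁ : X₁.PosDef) (hX₂ : X₂.PosDef)
    (A₁ A₂ : Matrix (Fin m ⊕ Fin r) (Fin m ⊕ Fin r) ℝ)
    (hA₁ : (Matrix.fromBlocks X₁ 0 0 X₂ * A₁).IsSymm)
    (hA₂ : (Matrix.fromBlocks X₁ 0 0 X₂ * A₂).IsSymm)
    (e : Matrix (Fin r) (Fin r) ℝ)
    (he : (X₂ * e + eᵀ * X₂).PosDef)
    (α β : ℝ)
    (hneg : (-(X₁ * (α • A₁.toBlocks₁₁ + β • A₂.toBlocks₁₁))).PosDef)
    (Ω : Set (ℝ × ℝ)) (hΩ : Bornology.IsBounded Ω) :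
    ∃ K ν : ℝ, 0 < ν ∧
      (∀ p : ℝ × ℝ, p ∈ closure Ω → 0 < K + α * p.1 + β * p.2) ∧
      ∀ U : ℝ × ℝ × ℝ → (Fin m ⊕ Fin r) → ℝ, ContDiff ℝ 1 U →
        (∀ t x y : ℝ,
          deriv (fun τ => U (τ, x, y)) t
            + A₁.mulVec (deriv (fun ξ => U (t, ξ, y)) x)
            + A₂.mulVec (deriv (fun η => U (t, x, η)) y)
            = (Matrix.fromBlocks 0 0 0 (-e)).mulVec (U (t, x, y))) →
        ∀ t x y : ℝ, (x, y) ∈ closure Ω →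
          deriv (fun τ => (K + α * x + β * y) *
              (U (τ, x, y) ⬝ᵥ (Matrix.fromBlocks X₁ 0 0 X₂).mulVec (U (τ, x, y)))) t
          + deriv (fun ξ => (K + α * ξ + β * y) *
              (U (t, ξ, y) ⬝ᵥ (Matrix.fromBlocks X₁ 0 0 X₂ * A₁).mulVec (U (t, ξ, y)))) x
          + deriv (fun η => (K + α * x + β * η) *
              (U (t, x, η) ⬝ᵥ (Matrix.fromBlocks X₁ 0 0 X₂ * A₂).mulVec (U (t, x, η)))) y
          ≤ -ν * ((K + α * x + β * y) *
              (U (t, x, y) ⬝ᵥ (Matrix.fromBlocks X₁ 0 0 X₂).mulVec (U (t, x, y)))) := by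
  set A₀ := fromBlocks X₁ 0 0 X₂ with hA₀
  have hA₀s : A₀.IsSymm :=
    .fromBlocks (by simpa using hX₁.isHermitian) (by simp) (by simpa using hX₂.isHermitian)
  have hM : (-(A₀ * (α • A₁ + β • A₂)).toBlocks₁₁).PosDef := by
    convert hneg using 2
    rw [hA₀]
    conv_lhs => rw [← fromBlocks_toBlocks (α • A₁ + β • A₂), fromBlocks_multiply]
    rw [toBlocks_fromBlocks₁₁, Matrix.zero_mul, add_zero]
    rfl
  obtain ⟨L₀, hL₀, hdecay⟩ := exists_uniform_block_decay _ hM he A₀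
  obtain ⟨C, hC⟩ := hΩ.exists_abs_linear_le α β
  obtain ⟨ν, hν, hdecay⟩ := hdecay (L₀ + 2 * |C|) (by positivity)
  have hbound : ∀ p ∈ closure Ω, L₀ ≤ L₀ + |C| + α * p.1 + β * p.2 ∧
      L₀ + |C| + α * p.1 + β * p.2 ≤ L₀ + 2 * |C| := fun p hp => by
    have := abs_le.mp ((hC p hp).trans (le_abs_self C))
    constructor <;> linarith
  refine ⟨L₀ + |C|, ν, hν, fun p hp => hL₀.trans_le (hbound p hp).1,
    fun U hU hpde t x y hxy => ?_⟩
  have hUd : Differentiable ℝ U := hU.differentiable one_ne_zero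
  have ht : HasDerivAt (fun τ => U (τ, x, y)) (deriv (fun τ => U (τ, x, y)) t) t :=
    DifferentiableAt.hasDerivAt (by fun_prop)
  have hx : HasDerivAt (fun ξ => U (t, ξ, y)) (deriv (fun ξ => U (t, ξ, y)) x) x :=
    DifferentiableAt.hasDerivAt (by fun_prop)
  have hy : HasDerivAt (fun η => U (t, x, η)) (deriv (fun η => U (t, x, η)) y) y :=
    DifferentiableAt.hasDerivAt (by fun_prop)
  have hlx : HasDerivAt (fun ξ => L₀ + |C| + α * ξ + β * y) α x := by
    simpa using (((hasDerivAt_id x).const_mul α).const_add (L₀ + |C|)).add_const (β * y)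
  have hly : HasDerivAt (fun η => L₀ + |C| + α * x + β * η) β y := by
    simpa using ((hasDerivAt_id y).const_mul β).const_add (L₀ + |C| + α * x)
  rw [((hasDerivAt_const t _).mul_quadratic_form hA₀s ht).deriv,
    (hlx.mul_quadratic_form hA₁ hx).deriv, (hly.mul_quadratic_form hA₂ hy).deriv]
  refine le_trans (le_of_eq ?_)
    (hdecay _ (hbound _ hxy).1 (hbound _ hxy).2 (U (t, x, y)))
  have hflux := congrArg (fun z => U (t, x, y) ⬝ᵥ (A₀ *ᵥ z)) (hpde t x y)
  simp only [mulVec_add, dotProduct_add, mulVec_mulVec] at hflux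
  set w := U (t, x, y)
  have hsource : 2 * (w ⬝ᵥ ((A₀ * fromBlocks 0 0 0 (-e)) *ᵥ w)) =
      -(w ∘ Sum.inr ⬝ᵥ ((X₂ * e + eᵀ * X₂) *ᵥ (w ∘ Sum.inr))) := by
    have hX₂e : eᵀ * X₂ = (X₂ * e)ᵀ := by
      rw [transpose_mul, ← conjTranspose_eq_transpose_of_trivial X₂, hX₂.isHermitian.eq]
    rw [hX₂e, add_mulVec, dotProduct_add, dotProduct_transpose_mulVec, hA₀, fromBlocks_multiply,
      fromBlocks_mulVec]
    conv_lhs => rw [← Sum.elim_comp_inl_inr w, sumElim_dotProduct_sumElim]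
    simp [neg_mulVec]
    ring
  have hM' : w ⬝ᵥ ((A₀ * (α • A₁ + β • A₂)) *ᵥ w) =
      α * (w ⬝ᵥ ((A₀ * A₁) *ᵥ w)) + β * (w ⬝ᵥ ((A₀ * A₂) *ᵥ w)) := by
    simp [mul_add, add_mulVec, smul_mulVec]
  rw [hM']
  linear_combination (L₀ + |C| + α * x + β * y) * (2 * hflux + hsource)
end

section
/- Let c be a real number with 0 < c < 1/2. Then the quadratic polynomial ct² + t + c has two distinct real roots, and there exists a real number k₂ ≠ −1 such that for all real numbers h, w satisfying h + w = k₂(h − w), one has hw + c(h² + w²) ≤ 0. -/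
/-- Control law (16) at the left sluice gate: for `0 < c < 1/2` the quadratic
`c t² + t + c` has two distinct real roots, and there is `k₂ ≠ -1` such that
every `(h, w)` with `h + w = k₂ (h - w)` satisfies `h w + c(h² + w²) ≤ 0`. -/
theorem stmt_16 (c : ℝ) (hc : 0 < c) (hc' : c < 1 / 2) :
    (∃ t₁ t₂ : ℝ, t₁ ≠ t₂ ∧ c * t₁ ^ 2 + t₁ + c = 0 ∧ c * t₂ ^ 2 + t₂ + c = 0) ∧
    ∃ k₂ : ℝ, k₂ ≠ -1 ∧ ∀ h w : ℝ, h + w = k₂ * (h - w) →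
      h * w + c * (h ^ 2 + w ^ 2) ≤ 0 := by
  refine ⟨?_, 0, by norm_num, fun h w hw => ?_⟩
  · have hdisc : 0 < 1 - 4 * c ^ 2 := by nlinarith
    set s := √(1 - 4 * c ^ 2)
    have hs_pos : 0 < s := Real.sqrt_pos.2 hdisc
    have hs_sq : s ^ 2 = 1 - 4 * c ^ 2 := Real.sq_sqrt hdisc.le
    refine ⟨(-1 + s) / (2 * c), (-1 - s) / (2 * c), ?_, ?_, ?_⟩
    · refine ne_of_gt (div_lt_div_of_pos_right ?_ (by positivity))
      linarith
    · field_simp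
      linear_combination hs_sq
    · field_simp
      linear_combination hs_sq
  · obtain rfl : w = -h := by linarith
    nlinarith [mul_nonneg (sq_nonneg h) (show 0 ≤ 1 - 2 * c by linarith)]
end
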